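/- For every integer k ≥ 1 and vectors α, γ, β of nonzero complex numbers with β := β_1⋯β_k, the matrix-valued function z ↦ φ^b(z;α,γ)·φ^g(z;β) (defined for z ∉ {0, β}) extends analytically to z = 0, and its value C''' at z = 0 is an upper triangular matrix with det C''' = (−1)^k α̂/β, where α̂ = α_1⋯α_k; in particular C''' is invertible. -/

import Mathlib

open scoped BigOperators

/-- The matrix `φ^b(z;α,γ)`: `diag(γ) + Σ_{i=1}^{k−1} α_i E_{i+1,i} + α_k z⁻¹ E_{1,k}`
(indices here are 0-based). -/
noncomputable def phiB (k : ℕ) (z : ℂ) (α γ : Fin k → ℂ) : Matrix (Fin k) (Fin k) ℂ :=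
  Matrix.of fun (i j : Fin k) =>
    (if i = j then γ i else 0) + (if (i : ℕ) = (j : ℕ) + 1 then α j else 0) +
      (if (i : ℕ) = 0 ∧ (j : ℕ) = k - 1 then α j * z⁻¹ else 0)

/-- Value of a `Fin k`-indexed vector at a natural number (1 outside range). -/
noncomputable def bval {k : ℕ} (β : Fin k → ℂ) (m : ℕ) : ℂ :=
  if h : m < k then β ⟨m, h⟩ else 1

/-- The matrix `φ^g(z;β) = (1 − β z⁻¹)⁻¹ G(z;β)` with
`G_{ij} = β_j⋯β_{i−1}` for `i ≥ j` and `G_{ij} = z⁻¹ (β_j⋯β_k)(β_1⋯β_{i−1})` for `i < j`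
(0-based indices). -/
noncomputable def phiG (k : ℕ) (z : ℂ) (β : Fin k → ℂ) : Matrix (Fin k) (Fin k) ℂ :=
  (1 - (∏ i, β i) * z⁻¹)⁻¹ •
    Matrix.of fun (i j : Fin k) =>
      if (j : ℕ) ≤ (i : ℕ) then ∏ m ∈ Finset.Ico (j : ℕ) (i : ℕ), bval β m
      else z⁻¹ * (∏ m ∈ Finset.Ico (j : ℕ) k, bval β m) * ∏ m ∈ Finset.Ico 0 (i : ℕ), bval β m


/-- The entries of `z • G(z;β)`, which are polynomial in `z`. -/
noncomputable def gaugeNumerator {k : ℕ} (β : Fin k → ℂ) (z : ℂ) (i j : ℕ) : ℂ :=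
  if j ≤ i then z * ∏ m ∈ Finset.Ico j i, bval β m
  else (∏ m ∈ Finset.Ico j k, bval β m) * ∏ m ∈ Finset.Ico 0 i, bval β m

/-- The entries of `(z − β) • φ^b(z;α,γ) φ^g(z;β)`, which are polynomial in `z`. -/
noncomputable def productNumerator {n : ℕ} (α γ β : Fin (n + 1) → ℂ) (z : ℂ)
    (i j : Fin (n + 1)) : ℂ :=
  γ i * gaugeNumerator β z i j +
    Fin.cases (α (Fin.last n) * ∏ m ∈ Finset.Ico (j : ℕ) n, bval β m)
      (fun l : Fin n => α l.castSucc * gaugeNumerator β z l j) i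

lemma bval_coe {k : ℕ} (β : Fin k → ℂ) (i : Fin k) : bval β i = β i := by
  simp [bval]

lemma prod_Ico_bval {k : ℕ} (β : Fin k → ℂ) :
    ∏ m ∈ Finset.Ico 0 k, bval β m = ∏ i, β i := by
  rw [Nat.Ico_zero_eq_range, ← Fin.prod_univ_eq_prod_range]
  simp only [bval_coe]

lemma prod_Ico_bval_split {k : ℕ} (β : Fin k → ℂ) (i : Fin k) :
    (∏ m ∈ Finset.Ico ((i : ℕ) + 1) k, bval β m) * (∏ m ∈ Finset.Ico 0 (i : ℕ), bval β m) * β i =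
      ∏ l, β l := by
  rw [← prod_Ico_bval β, ← Finset.prod_Ico_consecutive _ (Nat.zero_le (i + 1)) i.isLt,
    Finset.prod_Ico_succ_top (Nat.zero_le _), bval_coe]
  ring

lemma phiG_apply {k : ℕ} (β : Fin k → ℂ) {z : ℂ} (hz : z ≠ 0) (i j : Fin k) :
    phiG k z β i j = (z - ∏ l, β l)⁻¹ * gaugeNumerator β z i j := by
  have h : (1 - (∏ l, β l) * z⁻¹)⁻¹ = (z - ∏ l, β l)⁻¹ * z := by
    rw [show 1 - (∏ l, β l) * z⁻¹ = (z - ∏ l, β l) * z⁻¹ by field_simp, mul_inv, inv_inv]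
  simp only [phiG, gaugeNumerator, Matrix.smul_apply, Matrix.of_apply, smul_eq_mul, h]
  split_ifs
  · ring
  · field_simp

lemma phiB_mul_apply_zero {n : ℕ} (z : ℂ) (α γ : Fin (n + 1) → ℂ)
    (A : Matrix (Fin (n + 1)) (Fin (n + 1)) ℂ) (j : Fin (n + 1)) :
    (phiB (n + 1) z α γ * A) 0 j =
      γ 0 * A 0 j + α (Fin.last n) * z⁻¹ * A (Fin.last n) j := by
  have h (x : Fin (n + 1)) : (x : ℕ) = n ↔ x = Fin.last n := by simp [Fin.ext_iff]
  simp [Matrix.mul_apply, phiB, h, add_mul, Finset.sum_add_distrib, ite_mul]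

lemma phiB_mul_apply_succ {n : ℕ} (z : ℂ) (α γ : Fin (n + 1) → ℂ)
    (A : Matrix (Fin (n + 1)) (Fin (n + 1)) ℂ) (i : Fin n) (j : Fin (n + 1)) :
    (phiB (n + 1) z α γ * A) i.succ j =
      γ i.succ * A i.succ j + α i.castSucc * A i.castSucc j := by
  have h (x : Fin (n + 1)) : (i : ℕ) = x ↔ i.castSucc = x := by simp [Fin.ext_iff]
  simp [Matrix.mul_apply, phiB, h, add_mul, Finset.sum_add_distrib, ite_mul]

lemma phiB_mul_phiG_apply {n : ℕ} (α γ β : Fin (n + 1) → ℂ) {z : ℂ} (hz : z ≠ 0)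
    (i j : Fin (n + 1)) :
    (phiB (n + 1) z α γ * phiG (n + 1) z β) i j =
      (z - ∏ l, β l)⁻¹ * productNumerator α γ β z i j := by
  cases i using Fin.cases with
  | zero =>
    rw [phiB_mul_apply_zero, phiG_apply β hz, phiG_apply β hz]
    have h : gaugeNumerator β z (Fin.last n) j = z * ∏ m ∈ Finset.Ico (j : ℕ) n, bval β m := by
      simp [gaugeNumerator, Nat.le_of_lt_succ j.isLt]
    simp only [h, productNumerator, Fin.cases_zero]
    field_simp
  | succ i =>
    rw [phiB_mul_apply_succ, phiG_apply β hz, phiG_apply β hz]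
    simp only [productNumerator, Fin.cases_succ, Fin.val_castSucc]
    ring

lemma analyticAt_gaugeNumerator {k : ℕ} (β : Fin k → ℂ) (i j : ℕ) (w : ℂ) :
    AnalyticAt ℂ (fun z => gaugeNumerator β z i j) w := by
  unfold gaugeNumerator
  split_ifs <;> fun_prop

lemma analyticAt_productNumerator {n : ℕ} (α γ β : Fin (n + 1) → ℂ) (i j : Fin (n + 1))
    (w : ℂ) : AnalyticAt ℂ (fun z => productNumerator α γ β z i j) w := by
  refine (analyticAt_const.mul (analyticAt_gaugeNumerator β i j w)).add ?_
  cases i using Fin.cases with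
  | zero => exact analyticAt_const
  | succ i => exact analyticAt_const.mul (analyticAt_gaugeNumerator β i j w)

lemma gaugeNumerator_zero_of_le {k : ℕ} (β : Fin k → ℂ) {i j : ℕ} (h : j ≤ i) :
    gaugeNumerator β 0 i j = 0 := by
  simp [gaugeNumerator, h]

lemma productNumerator_zero_of_lt {n : ℕ} (α γ β : Fin (n + 1) → ℂ) {i j : Fin (n + 1)}
    (h : j < i) : productNumerator α γ β 0 i j = 0 := by
  cases i using Fin.cases with
  | zero => exact absurd h (Fin.not_lt_zero j)
  | succ i =>
    have hji : (j : ℕ) ≤ i := Nat.le_of_lt_succ h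
    simp [productNumerator, gaugeNumerator_zero_of_le β hji,
      gaugeNumerator_zero_of_le β (hji.trans (Nat.le_succ _))]

lemma productNumerator_zero_diag_zero {n : ℕ} (α γ β : Fin (n + 1) → ℂ)
    (hβ : ∀ i, β i ≠ 0) :
    (0 - ∏ l, β l)⁻¹ * productNumerator α γ β 0 0 0 = -(α (Fin.last n) / β (Fin.last n)) := by
  have h := prod_Ico_bval_split β (Fin.last n)
  have hp : ∏ l, β l ≠ 0 := Finset.prod_ne_zero_iff.mpr fun i _ => hβ i
  have hl := hβ (Fin.last n)
  simp only [Fin.val_last, Finset.Ico_self, Finset.prod_empty, one_mul] at h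
  simp only [productNumerator, gaugeNumerator_zero_of_le β le_rfl, Fin.cases_zero,
    Fin.val_zero, mul_zero, zero_add, zero_sub, inv_neg]
  field_simp
  rw [← h]
  ring

lemma productNumerator_zero_diag_succ {n : ℕ} (α γ β : Fin (n + 1) → ℂ)
    (hβ : ∀ i, β i ≠ 0) (i : Fin n) :
    (0 - ∏ l, β l)⁻¹ * productNumerator α γ β 0 i.succ i.succ =
      -(α i.castSucc / β i.castSucc) := by
  have h := prod_Ico_bval_split β i.castSucc
  have hp : ∏ l, β l ≠ 0 := Finset.prod_ne_zero_iff.mpr fun i _ => hβ i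
  have hl := hβ i.castSucc
  simp only [Fin.val_castSucc] at h
  simp only [productNumerator, gaugeNumerator_zero_of_le β le_rfl, Fin.cases_succ,
    mul_zero, zero_add, zero_sub, inv_neg]
  simp only [gaugeNumerator, Fin.val_succ, Nat.not_succ_le_self, if_false]
  field_simp
  rw [← h]
  ring

/-- The product `z ↦ φ^b(z;α,γ)·φ^g(z;β)` extends analytically to `z = 0`, with value there
an upper triangular matrix `C'''` satisfying `det C''' = (−1)^k α̂/β`; in particular `C'''`
is invertible. -/
theorem statement4 (k : ℕ) (hk : 1 ≤ k) (α γ β : Fin k → ℂ)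
    (hα : ∀ i, α i ≠ 0) (hγ : ∀ i, γ i ≠ 0) (hβ : ∀ i, β i ≠ 0) :
    ∃ F : ℂ → Matrix (Fin k) (Fin k) ℂ,
      (∀ i j : Fin k, AnalyticAt ℂ (fun z => F z i j) 0) ∧
      (∀ z : ℂ, z ≠ 0 → z ≠ ∏ i, β i → F z = phiB k z α γ * phiG k z β) ∧
      (∀ i j : Fin k, j < i → F 0 i j = 0) ∧
      (F 0).det = (-1 : ℂ) ^ k * (∏ i, α i) / (∏ i, β i) ∧
      IsUnit (F 0) := by
  obtain ⟨n, rfl⟩ := Nat.exists_eq_add_of_le' hk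
  have hp : ∏ l, β l ≠ 0 := Finset.prod_ne_zero_iff.mpr fun i _ => hβ i
  have hq : ∏ l, α l ≠ 0 := Finset.prod_ne_zero_iff.mpr fun i _ => hα i
  let F : ℂ → Matrix (Fin (n + 1)) (Fin (n + 1)) ℂ := fun z =>
    Matrix.of fun i j => (z - ∏ l, β l)⁻¹ * productNumerator α γ β z i j
  have htri : ∀ i j : Fin (n + 1), j < i → F 0 i j = 0 := fun i j h => by
    simp [F, productNumerator_zero_of_lt α γ β h]
  have hdet : (F 0).det = (-1 : ℂ) ^ (n + 1) * (∏ i, α i) / (∏ i, β i) := by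
    rw [Matrix.det_of_isUpperTriangular fun i j h => htri i j h, Fin.prod_univ_succ]
    simp only [F, Matrix.of_apply, productNumerator_zero_diag_zero α γ β hβ,
      productNumerator_zero_diag_succ α γ β hβ]
    rw [mul_comm, ← Fin.prod_univ_castSucc (fun i => -(α i / β i)), Finset.prod_neg,
      Finset.prod_div_distrib, Finset.card_univ, Fintype.card_fin, mul_div_assoc]
  refine ⟨F, fun i j => ?_, fun z hz _ => ?_, htri, hdet, ?_⟩
  · have h : (0 : ℂ) - ∏ l, β l ≠ 0 := by simpa using hp
    exact ((analyticAt_id.sub analyticAt_const).inv h).mul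
      (analyticAt_productNumerator α γ β i j 0)
  · ext i j
    exact (phiB_mul_phiG_apply α γ β hz i j).symm
  · rw [Matrix.isUnit_iff_isUnit_det, hdet, isUnit_iff_ne_zero]
    exact div_ne_zero (mul_ne_zero (pow_ne_zero _ (by norm_num)) hq) hp
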